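/- Let φ : [0,∞) → ℝ be a CMF with φ(0) = 1 and lim_{x→∞} φ(x) = 0, let 0 < p ≤ 1, and set κ(θ,θ') = φ(|θ − θ'|^p) for θ,θ' ∈ ℝ. Then for every k ≥ 1 and all pairwise distinct θ_1,…,θ_k ∈ ℝ, the Gram matrix G ∈ ℝ^{k×k} with entries G[ℓ,ℓ'] = κ(θ_ℓ, θ_{ℓ'}) is positive definite (hence invertible), and for every θ ∈ ℝ \ {θ_1,…,θ_k} one has ‖G⁻¹ g_θ‖₁ < 1, where g_θ ∈ ℝ^k has entries g_θ[ℓ] = κ(θ, θ_ℓ). (This is the Exact Recovery Condition underlying k-step recovery by Orthogonal Matching Pursuit in one-dimensional CMF dictionaries.) -/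

import Mathlib

/-- `φ` is a completely monotone function (CMF) on `[0,∞)`: infinitely differentiable
on `(0,∞)`, right-continuous at `0`, with `(-1)^n φ^(n)(x) ≥ 0` for all `x > 0`, `n ∈ ℕ`. -/
def IsCMF (φ : ℝ → ℝ) : Prop :=
  ContDiffOn ℝ (⊤ : ℕ∞) φ (Set.Ioi 0) ∧
  ContinuousWithinAt φ (Set.Ici 0) 0 ∧
  ∀ (n : ℕ) (x : ℝ), 0 < x → 0 ≤ (-1 : ℝ) ^ n * iteratedDeriv n φ x

/-- `‖x‖_p^p = Σ_d |x[d]|^p` on `ℝ^D`. -/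
noncomputable def pPowSum {D : ℕ} (p : ℝ) (x : Fin D → ℝ) : ℝ := ∑ d, |x d| ^ p


/-- complete monotonicity up to order `n`. -/
def CMn : ℕ → (ℝ → ℝ) → Prop
  | 0, f => ∀ x, 0 < x → 0 ≤ f x
  | n + 1, f => (∀ x, 0 < x → 0 ≤ f x) ∧
      ∃ f' : ℝ → ℝ, (∀ x, 0 < x → HasDerivAt f (-(f' x)) x) ∧ CMn n f'

theorem CMn.nonneg {n : ℕ} {f : ℝ → ℝ} (h : CMn n f) : ∀ x, 0 < x → 0 ≤ f x := by
  cases n with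
  | zero => exact h
  | succ n => exact h.1

theorem CMn.down {n : ℕ} : ∀ {f : ℝ → ℝ}, CMn (n + 1) f → CMn n f := by
  induction n with
  | zero => intro f h; exact h.1
  | succ n ih =>
    rintro f ⟨h0, f', hf', h⟩
    exact ⟨h0, f', hf', ih h⟩

theorem CMn.add {n : ℕ} : ∀ {f g : ℝ → ℝ}, CMn n f → CMn n g → CMn n (fun x => f x + g x) := by
  induction n with
  | zero => intro f g hf hg x hx; exact add_nonneg (hf x hx) (hg x hx)
  | succ n ih =>
    rintro f g ⟨h0, f', hf', h⟩ ⟨k0, g', hg', k⟩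
    refine ⟨fun x hx => add_nonneg (h0 x hx) (k0 x hx), fun x => f' x + g' x, fun x hx => ?_, ih h k⟩
    have := (hf' x hx).add (hg' x hx)
    rw [neg_add]; exact this

theorem CMn.mul {n : ℕ} : ∀ {f g : ℝ → ℝ}, CMn n f → CMn n g → CMn n (fun x => f x * g x) := by
  induction n with
  | zero => intro f g hf hg x hx; exact mul_nonneg (hf x hx) (hg x hx)
  | succ n ih =>
    intro f g hf hg
    have hf1 := hf.down
    have hg1 := hg.down
    obtain ⟨h0, f', hf', h⟩ := hf
    obtain ⟨k0, g', hg', k⟩ := hg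
    refine ⟨fun x hx => mul_nonneg (h0 x hx) (k0 x hx), fun x => f' x * g x + f x * g' x,
      fun x hx => ?_, (ih h hg1).add (ih hf1 k)⟩
    have := (hf' x hx).mul (hg' x hx)
    exact this.congr_deriv (by ring)

theorem CMn.comp {n : ℕ} : ∀ {f g B : ℝ → ℝ}, CMn n f → (∀ x, 0 < x → 0 < g x) →
    (∀ x, 0 < x → HasDerivAt g (B x) x) → CMn n B → CMn n (fun x => f (g x)) := by
  induction n with
  | zero => intro f g B hf hg hB h x hx; exact hf _ (hg x hx)
  | succ n ih =>
    rintro f g B ⟨h0, f', hf', h⟩ hg hB hB'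
    refine ⟨fun x hx => h0 _ (hg x hx), fun x => f' (g x) * B x, fun x hx => ?_,
      (ih h hg hB hB'.down).mul hB'.down⟩
    have := (hf' _ (hg x hx)).comp x (hB x hx)
    exact this.congr_deriv (by ring)

theorem CMn.anti {n : ℕ} {f : ℝ → ℝ} (h : CMn (n + 1) f) : AntitoneOn f (Set.Ioi 0) := by
  obtain ⟨h0, f', hf', h⟩ := h
  refine antitoneOn_of_deriv_nonpos (convex_Ioi 0)
    (fun x hx => (hf' x hx).continuousAt.continuousWithinAt) ?_ ?_
  · intro x hx
    rw [interior_Ioi] at hx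
    exact (hf' x hx).differentiableAt.differentiableWithinAt
  · intro x hx
    rw [interior_Ioi] at hx
    rw [(hf' x hx).deriv]
    have := h.nonneg x hx
    linarith

theorem CMn.diff {n : ℕ} : ∀ {f : ℝ → ℝ} (h : ℝ), 0 < h → CMn (n + 1) f →
    CMn n (fun x => f x - f (x + h)) := by
  induction n with
  | zero =>
    intro f h hh hf x hx
    have : f (x + h) ≤ f x := hf.anti hx (show (0:ℝ) < x + h by linarith) (by linarith)
    show 0 ≤ f x - f (x + h)
    linarith
  | succ n ih =>
    intro f h hh hf
    have hanti := hf.anti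
    obtain ⟨h0, f', hf', hd⟩ := hf
    refine ⟨fun x hx => ?_, fun x => f' x - f' (x + h), fun x hx => ?_, ih h hh hd⟩
    · have : f (x + h) ≤ f x := hanti hx (show (0:ℝ) < x + h by linarith) (by linarith)
      show 0 ≤ f x - f (x + h)
      linarith
    · have h2 : HasDerivAt (fun y => f (y + h)) (-(f' (x + h))) x := by
        have := (hf' (x + h) (by linarith)).comp_add_const x h
        exact this
      have := (hf' x hx).sub h2
      exact this.congr_deriv (by ring)

theorem CMn.rpow (n : ℕ) : ∀ (C q : ℝ), 0 ≤ C → q ≤ 0 → CMn n (fun x => C * x ^ q) := by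
  induction n with
  | zero => intro C q hC hq x hx; exact mul_nonneg hC (Real.rpow_nonneg hx.le _)
  | succ n ih =>
    intro C q hC hq
    refine ⟨fun x hx => mul_nonneg hC (Real.rpow_nonneg hx.le _), fun x => (C * (-q)) * x ^ (q - 1),
      fun x hx => ?_, ih _ _ (mul_nonneg hC (by linarith)) (by linarith)⟩
    have := (Real.hasDerivAt_rpow_const (x := x) (p := q) (Or.inl hx.ne')).const_mul C
    exact this.congr_deriv (by ring)

theorem cmn_of_iter {f : ℝ → ℝ} (h1 : ContDiffOn ℝ (⊤ : ℕ∞) f (Set.Ioi 0))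
    (h3 : ∀ (n : ℕ) (x : ℝ), 0 < x → 0 ≤ (-1 : ℝ) ^ n * iteratedDeriv n f x) (n : ℕ) :
    ∀ m : ℕ, CMn n (fun x => (-1 : ℝ) ^ m * iteratedDeriv m f x) := by
  induction n with
  | zero => intro m x hx; exact h3 m x hx
  | succ n ih =>
    intro m
    refine ⟨fun x hx => h3 m x hx, _, fun x hx => ?_, ih (m + 1)⟩
    have hc : ContDiffAt ℝ (⊤ : ℕ∞) f x := h1.contDiffAt (Ioi_mem_nhds hx)
    have hd : DifferentiableAt ℝ (iteratedDeriv m f) x :=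
      by
      have hw := (h1.differentiableOn_iteratedDerivWithin (m := m)
        (by exact_mod_cast WithTop.coe_lt_top m) isOpen_Ioi.uniqueDiffOn).differentiableAt
        (Ioi_mem_nhds hx)
      refine hw.congr_of_eventuallyEq ?_
      filter_upwards [Ioi_mem_nhds hx] with y hy
      exact (iteratedDerivWithin_of_isOpen isOpen_Ioi hy).symm
    have := hd.hasDerivAt.const_mul ((-1 : ℝ) ^ m)
    exact this.congr_deriv (by rw [iteratedDeriv_succ]; ring)

theorem cmn_psi {f : ℝ → ℝ} (h1 : ContDiffOn ℝ (⊤ : ℕ∞) f (Set.Ioi 0))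
    (h3 : ∀ (n : ℕ) (x : ℝ), 0 < x → 0 ≤ (-1 : ℝ) ^ n * iteratedDeriv n f x)
    (p : ℝ) (hp0 : 0 < p) (hp1 : p ≤ 1) (n : ℕ) : CMn n (fun x => f (x ^ p)) := by
  have h : CMn n f := by simpa using cmn_of_iter h1 h3 n 0
  refine h.comp (fun x hx => Real.rpow_pos_of_pos hx p) (fun x hx => ?_)
    (CMn.rpow n p (p - 1) hp0.le (by linarith))
  exact Real.hasDerivAt_rpow_const (Or.inl hx.ne')


def shE : Module.End ℝ (ℕ → ℝ) where
  toFun a := fun n => a (n + 1)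
  map_add' _ _ := rfl
  map_smul' _ _ := rfl

theorem shE_pow (i : ℕ) (a : ℕ → ℝ) (n : ℕ) : (shE ^ i) a n = a (n + i) := by
  induction i generalizing a with
  | zero => simp
  | succ i ih =>
    rw [pow_succ, Module.End.mul_apply, ih]
    show a _ = a _
    congr 1

theorem cmn_seq (k : ℕ) : ∀ (f : ℝ → ℝ) (h : ℝ), 0 < h → CMn k f → ∀ n : ℕ,
    0 ≤ ((1 - shE) ^ k) (fun n : ℕ => f ((n + 1) * h)) n := by
  induction k with
  | zero =>
    intro f h hh hf n
    simpa using hf ((n + 1) * h) (by positivity)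
  | succ k ih =>
    intro f h hh hf n
    have := ih _ h hh (hf.diff h hh) n
    rw [pow_succ, Module.End.mul_apply]
    convert this using 2
    funext m
    simp [shE]
    congr 1
    ring

theorem hausdorff_id (a : ℕ → ℝ) (n m : ℕ) :
    a n = ∑ i ∈ Finset.range (m + 1), (m.choose i : ℝ) * ((1 - shE) ^ (m - i)) a (n + i) := by
  have hc : Commute shE (1 - shE) := (Commute.one_right shE).sub_right (Commute.refl shE)
  have h := hc.add_pow m
  have h1 : shE + (1 - shE) = 1 := by abel
  rw [h1, one_pow] at h
  have h2 := congrArg (fun T : Module.End ℝ (ℕ → ℝ) => T a n) h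
  simp only [Module.End.one_apply] at h2
  rw [h2, LinearMap.sum_apply, Finset.sum_apply]
  refine Finset.sum_congr rfl fun i hi => ?_
  rw [Module.End.mul_apply, Module.End.mul_apply, shE_pow]
  have : ((m.choose i : ℕ) : Module.End ℝ (ℕ → ℝ)) a = (m.choose i : ℝ) • a := by
    rw [Module.End.natCast_apply]; funext t; simp
  rw [this, map_smul]; simp

theorem hausdorff_id' (a : ℕ → ℝ) (n N : ℕ) (hn : n ≤ N) :
    a n = ∑ j ∈ Finset.range (N + 1), ((N.choose j : ℝ) * ((1 - shE) ^ (N - j)) a j) *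
      ((j.descFactorial n : ℝ) / N.descFactorial n) := by
  obtain ⟨m, rfl⟩ := Nat.exists_eq_add_of_le hn
  rw [add_assoc, Finset.sum_range_add]
  have h0 : ∑ j ∈ Finset.range n, (((n + m).choose j : ℝ) * ((1 - shE) ^ (n + m - j)) a j) *
      ((j.descFactorial n : ℝ) / (n + m).descFactorial n) = 0 := by
    refine Finset.sum_eq_zero fun j hj => ?_
    rw [Nat.descFactorial_eq_zero_iff_lt.2 (Finset.mem_range.1 hj)]
    simp
  rw [h0, zero_add, hausdorff_id a n m]
  refine Finset.sum_congr rfl fun i hi => ?_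
  have hi' : i ≤ m := by simpa [Nat.lt_succ_iff] using hi
  have e : n + m - (n + i) = m - i := by omega
  rw [e]
  have hpos : (0:ℝ) < (n + m).descFactorial n := by
    exact_mod_cast Nat.descFactorial_pos.2 (by omega)
  have key : ((n + m).choose (n + i) : ℝ) * (n + i).descFactorial n
      = m.choose i * (n + m).descFactorial n := by
    have h1 := Nat.choose_mul (n := n + m) (k := n + i) (s := n) (by omega)
    rw [show n + m - n = m by omega, show n + i - n = i by omega] at h1
    have h2 : (n + m).choose (n + i) * (n + i).descFactorial n
      = m.choose i * (n + m).descFactorial n := by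
      rw [Nat.descFactorial_eq_factorial_mul_choose, Nat.descFactorial_eq_factorial_mul_choose]
      calc _ = n.factorial * ((n + m).choose (n + i) * (n + i).choose n) := by ring
        _ = _ := by rw [h1]; ring
    exact_mod_cast h2
  field_simp
  linear_combination (-((1 - shE) ^ (m - i)) a (n + i)) * key

theorem desc_est (L N j : ℕ) (hL : L < N) (hj : j ≤ N) : ∀ n : ℕ, n ≤ L →
    |(j.descFactorial n : ℝ) / N.descFactorial n - ((j + 1) / (N + 2)) ^ n|
      ≤ n * ((3 + 3 * L) / (N - L)) ∧ (j.descFactorial n : ℝ) / N.descFactorial n ≤ 1 := by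
  intro n
  induction n with
  | zero => intro _; simp
  | succ n ih =>
    intro hn
    obtain ⟨ih1, ih2⟩ := ih (by omega)
    have hjr : (j : ℝ) ≤ N := by exact_mod_cast hj
    have hnr : (n : ℝ) + 1 ≤ L := by exact_mod_cast hn
    have hLr : (L : ℝ) < N := by exact_mod_cast hL
    have hcast : ((N - n : ℕ) : ℝ) = N - n := by rw [Nat.cast_sub (by omega)]
    have hNn : (0 : ℝ) < N - n := by linarith
    have hn0 : (0:ℝ) ≤ n := Nat.cast_nonneg n
    have hj0 : (0:ℝ) ≤ j := Nat.cast_nonneg j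
    set x : ℝ := ((j - n : ℕ) : ℝ) / (N - n) with hx
    set r : ℝ := (j + 1) / (N + 2) with hr
    have hr0 : 0 ≤ r := by positivity
    have hr1 : r ≤ 1 := by rw [hr, div_le_one (by linarith)]; linarith
    have hx0 : 0 ≤ x := by positivity
    have hx1 : x ≤ 1 := by
      rw [hx, div_le_one hNn, ← hcast]
      exact_mod_cast Nat.sub_le_sub_right hj n
    have hxr : |x - r| ≤ (3 + 3 * L) / (N - L) := by
      rcases le_total n j with h | h
      · have : x - r = (2 * j - n * N - n + n * j - N) / ((N - n) * (N + 2)) := by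
          rw [hx, hr, Nat.cast_sub h]
          have : (N:ℝ) + 2 ≠ 0 := by linarith
          field_simp
          ring
        rw [this, abs_div, abs_of_pos (show (0:ℝ) < (N - n) * (N + 2) by
          apply mul_pos hNn; linarith), div_le_div_iff₀ (by apply mul_pos hNn; linarith) (by linarith)]
        have h1 : |(2 * j - n * N - n + n * j - N : ℝ)| ≤ (3 + 3 * n) * N := by
          have a1 : (n:ℝ) * j ≤ n * N := by gcongr
          have a2 : 0 ≤ (n:ℝ) * j := by positivity
          have a3 : (n:ℝ) ≤ n * N := by
            have : (1:ℝ) ≤ N := by exact_mod_cast (by omega : 1 ≤ N)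
            nlinarith
          rw [abs_le]; constructor <;> nlinarith
        calc _ ≤ ((3 + 3 * n) * N) * (N - L : ℝ) := by gcongr
          _ ≤ ((3 + 3 * L) * (N + 2)) * (N - n : ℝ) := by
            gcongr <;> linarith
          _ = _ := by ring
      · have : x = 0 := by rw [hx, Nat.sub_eq_zero_of_le h]; simp
        rw [this, zero_sub, abs_neg, abs_of_nonneg hr0, hr,
          div_le_div_iff₀ (by linarith) (by linarith)]
        have : (j:ℝ) ≤ n := by exact_mod_cast h
        have : (j:ℝ) + 1 ≤ L := by linarith
        calc _ ≤ (L:ℝ) * (N - L) := by gcongr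
          _ ≤ (3 + 3 * L) * (N + 2) := by gcongr <;> linarith
    have hq : ((j.descFactorial (n+1) : ℕ) : ℝ) / (N.descFactorial (n+1) : ℕ)
        = x * ((j.descFactorial n : ℝ) / N.descFactorial n) := by
      rw [Nat.descFactorial_succ, Nat.descFactorial_succ]
      push_cast [hcast]
      rw [hx, mul_div_mul_comm]
    have hq0 : 0 ≤ (j.descFactorial n : ℝ) / N.descFactorial n := by positivity
    rw [hq]
    set q := (j.descFactorial n : ℝ) / N.descFactorial n
    refine ⟨?_, by nlinarith⟩
    have : x * q - r ^ (n + 1) = (x - r) * q + r * (q - r ^ n) := by ring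
    rw [this]
    calc _ ≤ |(x - r) * q| + |r * (q - r ^ n)| := abs_add_le _ _
      _ ≤ |x - r| * 1 + 1 * |q - r ^ n| := by
        rw [abs_mul, abs_mul, abs_of_nonneg hq0, abs_of_nonneg hr0]; gcongr
      _ ≤ _ := by push_cast; linarith

theorem hausdorff_approx (a : ℕ → ℝ) (ha : ∀ k n, 0 ≤ ((1 - shE : Module.End ℝ (ℕ → ℝ)) ^ k) a n) (L : ℕ) (ε : ℝ)
    (hε : 0 < ε) : ∃ (J : ℕ) (w r : Fin J → ℝ), (∀ j, 0 ≤ w j) ∧ (∀ j, 0 < r j) ∧ (∀ j, r j < 1) ∧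
      ∀ n ≤ L, |∑ j, w j * r j ^ n - a n| ≤ ε := by
  have hlim : Filter.Tendsto (fun N : ℕ => (L * ((3 + 3 * L) / ((N:ℝ) - L))) * a 0) Filter.atTop
      (nhds 0) := by
    have : Filter.Tendsto (fun N : ℕ => (N:ℝ) - L) Filter.atTop Filter.atTop :=
      Filter.tendsto_atTop_add_const_right _ _ tendsto_natCast_atTop_atTop
    have h2 := ((this.const_div_atTop (3 + 3 * (L:ℝ))).const_mul (L:ℝ)).mul_const (a 0)
    simpa using h2
  obtain ⟨N, hN1, hN2⟩ := ((hlim.eventually (gt_mem_nhds hε)).and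
    (Filter.eventually_gt_atTop L)).exists
  set W : ℕ → ℝ := fun j => (N.choose j : ℝ) * ((1 - shE) ^ (N - j)) a j with hW
  have hW0 : ∀ j, 0 ≤ W j := fun j => mul_nonneg (Nat.cast_nonneg _) (ha _ _)
  refine ⟨N + 1, fun j => W j, fun j => ((j:ℕ) + 1) / (N + 2), fun j => hW0 _, fun j => by positivity,
    fun j => ?_, fun n hn => ?_⟩
  · have : (j:ℝ) < N + 1 := by exact_mod_cast j.2
    rw [div_lt_one (by positivity)]; linarith
  · rw [Fin.sum_univ_eq_sum_range (fun j => W j * (((j:ℝ) + 1) / (N + 2)) ^ n) (N + 1),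
      hausdorff_id' a n N (by omega), ← Finset.sum_sub_distrib]
    have hs : a 0 = ∑ j ∈ Finset.range (N + 1), W j := by
      simpa using hausdorff_id' a 0 N (by omega)
    refine le_trans (Finset.abs_sum_le_sum_abs _ _) (le_trans ?_ hN1.le)
    rw [hs, Finset.mul_sum]
    refine Finset.sum_le_sum fun j hj => ?_
    rw [← mul_sub, abs_mul, abs_of_nonneg (hW0 j), mul_comm]
    refine mul_le_mul_of_nonneg_right ?_ (hW0 j)
    rw [abs_sub_comm]
    refine (desc_est L N j hN2 (by simpa [Nat.lt_succ_iff] using hj) n hn).1.trans ?_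
    have : (L:ℝ) < N := by exact_mod_cast hN2
    have : (0:ℝ) < N - L := by linarith
    gcongr

theorem arrow_unit {E : Type*} [NormedAddCommGroup E] [InnerProductSpace ℝ E] [FiniteDimensional ℝ E]
    (D : E →ₗ[ℝ] E) (hD : D.IsSymmetric) (hpos : ∀ x : E, x ≠ 0 → 2 * inner ℝ x x < inner ℝ (D x) x)
    (e : E) (he : inner ℝ e e = (1:ℝ)) :
    ∃ (n : ℕ) (f : Fin n → E) (σ β : Fin n → ℝ) (d : ℝ), (∀ k, 2 < σ k) ∧
      (∀ k, D (f k) = σ k • f k + β k • e) ∧ (D e = d • e + ∑ k, β k • f k) ∧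
      0 < d - 2 - ∑ k, β k ^ 2 / (σ k - 2) ∧ ∀ k, inner ℝ e (f k) = (0:ℝ) := by
  set W : Submodule ℝ E := (Submodule.span ℝ {e})ᗮ with hW
  have hmem : ∀ x : E, x ∈ W ↔ inner ℝ e x = (0:ℝ) := fun x => by
    rw [hW, Submodule.mem_orthogonal_singleton_iff_inner_right]
  have hP : ∀ x : E, (W.orthogonalProjectionOnto x : E) = x - (inner ℝ e x : ℝ) • e := by
    intro x
    have : W.starProjection x = x - (inner ℝ e x : ℝ) • e := by
      refine Submodule.eq_starProjection_of_mem_of_inner_eq_zero ?_ ?_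
      · rw [hmem, inner_sub_right, inner_smul_right, he]; ring
      · intro w hw
        rw [hmem] at hw
        simp [inner_smul_left, hw]
    exact this
  let T : W →ₗ[ℝ] W := (W.orthogonalProjectionOnto : E →ₗ[ℝ] W) ∘ₗ D ∘ₗ W.subtype
  have hTa : ∀ x : W, T x = W.orthogonalProjectionOnto (D x) := fun x => rfl
  have hin : ∀ (x : E) (y : W), inner ℝ (W.orthogonalProjectionOnto x) y = (inner ℝ x (y:E) : ℝ) := by
    intro x y
    rw [Submodule.coe_inner, hP, inner_sub_left, inner_smul_left, (hmem y).1 y.2]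
    simp
  have hT : T.IsSymmetric := by
    intro x y
    rw [hTa, hTa, hin, hD x y, real_inner_comm, ← hin, real_inner_comm]
  let b := hT.eigenvectorBasis rfl
  let σ := hT.eigenvalues rfl
  have hb : ∀ k, T (b k) = σ k • b k := fun k => hT.apply_eigenvectorBasis rfl k
  have hbb : ∀ k, (inner ℝ (b k : E) (b k : E) : ℝ) = 1 := by
    intro k
    have := b.orthonormal.1 k
    rw [← Submodule.coe_inner, real_inner_self_eq_norm_sq, this]; norm_num
  have hDb : ∀ k, D (b k : E) = σ k • (b k : E) + (inner ℝ e (D (b k)) : ℝ) • e := by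
    intro k
    have h := congrArg (Subtype.val) (hb k)
    rw [hTa, hP] at h
    rw [sub_eq_iff_eq_add] at h
    simpa using h
  have hbe : ∀ k, (inner ℝ e (b k : E) : ℝ) = 0 := fun k => (hmem _).1 (b k).2
  have hσ : ∀ k, 2 < σ k := by
    intro k
    have hne : (b k : E) ≠ 0 := by
      intro h; have := hbb k; rw [h] at this; simp at this
    have := hpos _ hne
    rw [hDb, inner_add_left, inner_smul_left, inner_smul_left, hbe, hbb] at this
    simpa using this
  have hDe : D e = (inner ℝ e (D e) : ℝ) • e + ∑ k, (inner ℝ e (D (b k)) : ℝ) • (b k : E) := by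
    have h := b.sum_repr' (W.orthogonalProjectionOnto (D e))
    have h2 := congrArg (Subtype.val) h
    rw [hP, eq_sub_iff_add_eq] at h2
    refine h2.symm.trans ?_
    rw [add_comm]
    congr 1
    rw [AddSubmonoidClass.coe_finsetSum]
    refine Finset.sum_congr rfl fun k _ => ?_
    rw [Submodule.coe_smul]
    congr 1
    rw [real_inner_comm, hin, hD]
  refine ⟨_, fun k => b k, σ, fun k => inner ℝ e (D (b k)), inner ℝ e (D e), hσ, hDb, hDe, ?_, hbe⟩
  set β : _ → ℝ := fun k => inner ℝ e (D (b k)) with hβ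
  set d : ℝ := inner ℝ e (D e)
  set z : E := e - ∑ k, (β k / (σ k - 2)) • (b k : E) with hz
  have hez : (inner ℝ e z : ℝ) = 1 := by
    rw [hz, inner_sub_right, inner_sum, he]
    simp [inner_smul_right, hbe]
  have hz0 : z ≠ 0 := by intro h; rw [h] at hez; simp at hez
  have hDz : D z = (2:ℝ) • z + (d - 2 - ∑ k, β k ^ 2 / (σ k - 2)) • e := by
    rw [hz, map_sub, map_sum, hDe]
    have : ∀ k, D ((β k / (σ k - 2)) • (b k : E))
        = β k • (b k : E) + (2:ℝ) • (β k / (σ k - 2)) • (b k : E) + (β k ^ 2 / (σ k - 2)) • e := by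
      intro k
      have : σ k - 2 ≠ 0 := by have := hσ k; linarith
      rw [map_smul, hDb, smul_add, smul_smul, smul_smul, smul_smul, ← add_smul]
      congr 2
      · field_simp; ring
      · change β k / (σ k - 2) * β k = _; ring
    rw [Finset.sum_congr rfl fun k _ => this k, Finset.sum_add_distrib, Finset.sum_add_distrib,
      ← Finset.smul_sum, ← Finset.sum_smul]
    module
  have := hpos z hz0
  rw [hDz, inner_add_left, inner_smul_left, inner_smul_left, hez] at this
  simpa using this

theorem arrow {J : ℕ} (s e : Fin J → ℝ) (hs : ∀ j, 2 < s j) (he : 0 < ∑ j, e j ^ 2) :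
    ∃ (n : ℕ) (f : Fin n → Fin J → ℝ) (σ β : Fin n → ℝ) (d : ℝ), (∀ k, 2 < σ k) ∧
      (∀ k j, s j * f k j = σ k * f k j + β k * e j) ∧
      (∀ j, s j * e j = d * e j + ∑ k, β k * f k j) ∧
      0 < d - 2 - ∑ k, β k ^ 2 / (σ k - 2) ∧ ∀ k, ∑ j, f k j * e j = 0 := by
  let D : EuclideanSpace ℝ (Fin J) →ₗ[ℝ] EuclideanSpace ℝ (Fin J) :=
    { toFun := fun x => WithLp.toLp 2 (fun j => s j * x j)
      map_add' := fun x y => by ext j; simp; ring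
      map_smul' := fun c x => by ext j; simp; ring }
  have hDj : ∀ x j, D x j = s j * x j := fun x j => rfl
  set α : ℝ := Real.sqrt (∑ j, e j ^ 2) with hα
  have hα0 : 0 < α := Real.sqrt_pos.2 he
  have hα2 : α * α = ∑ j, e j ^ 2 := Real.mul_self_sqrt he.le
  obtain ⟨n, f, σ, β, d, h1, h2, h3, h4, h6⟩ := arrow_unit D
    (by
      intro x y
      simp only [PiLp.inner_apply, hDj]
      refine Finset.sum_congr rfl fun j _ => ?_
      simp; ring)
    (by
      intro x hx
      have hx' : ∃ j, x j ≠ 0 := by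
        by_contra h
        push Not at h
        exact hx (by ext j; simpa using h j)
      obtain ⟨j, hj⟩ := hx'
      simp only [PiLp.inner_apply, hDj]
      rw [Finset.mul_sum]
      refine Finset.sum_lt_sum (fun i _ => ?_) ⟨j, Finset.mem_univ _, ?_⟩
      · simp only [RCLike.inner_apply, conj_trivial]
        nlinarith [hs i, mul_self_nonneg (x i)]
      · simp only [RCLike.inner_apply, conj_trivial]
        nlinarith [hs j, mul_self_pos.2 hj])
    (WithLp.toLp 2 (fun j => α⁻¹ * e j))
    (by
      simp only [PiLp.inner_apply, RCLike.inner_apply, conj_trivial]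
      have : ∀ j, α⁻¹ * e j * (α⁻¹ * e j) = (α * α)⁻¹ * e j ^ 2 := fun j => by
        rw [mul_inv]; ring
      rw [Finset.sum_congr rfl fun j _ => this j, ← Finset.mul_sum, ← hα2]
      field_simp)
  refine ⟨n, fun k j => α * f k j, σ, β, d, h1, fun k j => ?_, fun j => ?_, h4, fun k => ?_⟩
  · have := congrArg (fun x : EuclideanSpace ℝ (Fin J) => x j) (h2 k)
    simp [hDj] at this
    field_simp at this
    linear_combination this
  · have := congrArg (fun x : EuclideanSpace ℝ (Fin J) => x j) h3
    simp [hDj] at this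
    have h5 : ∑ k, β k * (α * f k j) = α * ∑ k, β k * f k j := by
      rw [Finset.mul_sum]; exact Finset.sum_congr rfl fun k _ => by ring
    rw [h5]
    field_simp at this
    linear_combination this
  · have := h6 k
    simp only [PiLp.inner_apply, RCLike.inner_apply, conj_trivial] at this
    have h7 : ∑ j, α * f k j * e j = α * α * ∑ j, f k j * (α⁻¹ * e j) := by
      rw [Finset.mul_sum]; exact Finset.sum_congr rfl fun k _ => by field_simp
    rw [h7, this, mul_zero]

theorem min_attained (u : ℤ → ℝ) (hu : Filter.Tendsto u Filter.cofinite (nhds 0)) (x : ℤ)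
    (hx : u x < 0) : ∃ x0, u x0 ≤ u x ∧ ∀ y, u x0 ≤ u y := by
  have hfin : {y | u y ≤ u x}.Finite := by
    have := hu.eventually (lt_mem_nhds hx)
    rw [Filter.eventually_cofinite] at this
    simpa using this
  obtain ⟨x0, h0, h1⟩ := Set.exists_min_image _ u hfin ⟨x, le_refl (u x)⟩
  refine ⟨x0, h0, fun y => ?_⟩
  by_cases hy : u y ≤ u x
  · exact h1 y hy
  · exact le_trans h0 (le_of_not_ge hy)

theorem resolvent_lower (U : ℤ → ℝ) (hU : Filter.Tendsto U Filter.cofinite (nhds 0)) (σ B : ℝ)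
    (hσ : 2 < σ) (hB : B ≤ 0) (h : ∀ x, B ≤ σ * U x - (U (x - 1) + U (x + 1))) (x : ℤ) :
    B / (σ - 2) ≤ U x := by
  by_contra hlt
  push Not at hlt
  have h0 : B / (σ - 2) ≤ 0 := div_nonpos_of_nonpos_of_nonneg hB (by linarith)
  obtain ⟨x0, h1, h2⟩ := min_attained U hU x (by linarith)
  have h3 := h x0
  have h4 := h2 (x0 - 1)
  have h5 := h2 (x0 + 1)
  have h6 : U x0 < B / (σ - 2) := by linarith
  rw [lt_div_iff₀ (by linarith)] at h6
  nlinarith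

theorem geom_tendsto (r : ℝ) (h0 : 0 < r) (h1 : r < 1) (t : ℤ) :
    Filter.Tendsto (fun x : ℤ => r ^ (x - t).natAbs) Filter.cofinite (nhds 0) := by
  have hA : Filter.Tendsto (fun x : ℤ => (x - t).natAbs) Filter.cofinite Filter.atTop := by
    rw [← Nat.cofinite_eq_atTop]
    refine Filter.Tendsto.cofinite_of_finite_preimage_singleton fun b => ?_
    refine (Set.finite_Icc (t - b) (t + b)).subset fun x hx => ?_
    simp only [Set.mem_preimage, Set.mem_singleton_iff] at hx
    simp only [Set.mem_Icc]
    omega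
  exact (tendsto_pow_atTop_nhds_zero_of_lt_one h0.le h1).comp hA

theorem geom_eq (r : ℝ) (h0 : 0 < r) (n : ℤ) :
    (r + r⁻¹) * r ^ n.natAbs - (r ^ (n - 1).natAbs + r ^ (n + 1).natAbs)
      = if n = 0 then r⁻¹ - r else 0 := by
  rcases lt_trichotomy n 0 with h | h | h
  · rw [if_neg h.ne]
    obtain ⟨m, hm⟩ : ∃ m : ℕ, n = -((m:ℤ) + 1) := ⟨(-n - 1).toNat, by omega⟩
    have e1 : n.natAbs = m + 1 := by omega
    have e2 : (n - 1).natAbs = m + 2 := by omega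
    have e3 : (n + 1).natAbs = m := by omega
    rw [e1, e2, e3]; field_simp; ring
  · subst h; simp
  · rw [if_neg h.ne']
    obtain ⟨m, hm⟩ : ∃ m : ℕ, n = (m:ℤ) + 1 := ⟨(n - 1).toNat, by omega⟩
    have e1 : n.natAbs = m + 1 := by omega
    have e2 : (n - 1).natAbs = m := by omega
    have e3 : (n + 1).natAbs = m + 2 := by omega
    rw [e1, e2, e3]; field_simp; ring

theorem mixture_principle {J : ℕ} {ι : Type*} [Fintype ι] (w r : Fin J → ℝ) (hw : ∀ j, 0 ≤ w j)
    (hw' : 0 < ∑ j, w j) (hr0 : ∀ j, 0 < r j) (hr1 : ∀ j, r j < 1) (K : ℤ → ℝ)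
    (hK : ∀ n, K n = ∑ j, w j * r j ^ n.natAbs) (τ : ι → ℤ) (a : ι → ℝ)
    (ha : ∀ i, 0 ≤ a i ∨ 0 ≤ ∑ i', a i' * K (τ i - τ i')) :
    (∀ x, 0 ≤ ∑ i', a i' * K (x - τ i')) ∧
    (Function.Injective τ → ∀ i, ∑ i', a i' * K (τ i - τ i') = 0 → a i ≤ 0) := by
  classical
  set c : Fin J → ℝ := fun j => (r j)⁻¹ - r j with hc
  have hc0 : ∀ j, 0 < c j := fun j => by
    have := (one_lt_inv₀ (hr0 j)).2 (hr1 j)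
    have := hr1 j
    simp only [hc]; linarith
  set s : Fin J → ℝ := fun j => r j + (r j)⁻¹ with hs
  have hs2 : ∀ j, 2 < s j := fun j => by
    have h0 := hr0 j
    have : s j - 2 = (1 - r j) ^ 2 / r j := by simp only [hs]; field_simp; ring
    have h3 : 0 < (1 - r j) ^ 2 / r j := div_pos (pow_pos (by linarith [hr1 j]) 2) h0
    linarith
  set e : Fin J → ℝ := fun j => Real.sqrt (w j * c j) with he
  have he2 : ∀ j, e j ^ 2 = w j * c j := fun j => Real.sq_sqrt (mul_nonneg (hw j) (hc0 j).le)
  set V : ℝ := ∑ j, e j ^ 2 with hV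
  have hV0 : 0 < V := by
    obtain ⟨j, _, hj⟩ := Finset.exists_lt_of_sum_lt (s := Finset.univ) (f := fun _ : Fin J => (0:ℝ))
      (g := w) (by simpa using hw')
    exact Finset.sum_pos' (fun j _ => sq_nonneg _) ⟨j, Finset.mem_univ _, by
      rw [he2]; exact mul_pos hj (hc0 j)⟩
  obtain ⟨n, f, σ, β, d, hσ, hf, hee, hpos, horth⟩ := arrow s e hs2 hV0
  set A : ℤ → ℝ := fun x => ∑ i, if x = τ i then a i else 0 with hA
  set X : Fin J → ℤ → ℝ := fun j x => e j / c j * ∑ i, a i * r j ^ (x - τ i).natAbs with hX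
  set u : ℤ → ℝ := fun x => ∑ i', a i' * K (x - τ i') with hu
  have huX : ∀ x, u x = ∑ j, e j * X j x := by
    intro x
    simp only [hu, hX, hK]
    simp_rw [Finset.mul_sum]
    rw [Finset.sum_comm]
    refine Finset.sum_congr rfl fun j _ => Finset.sum_congr rfl fun i _ => ?_
    have : w j = e j * (e j / c j) := by
      rw [← mul_div_assoc, ← sq, he2]; field_simp [(hc0 j).ne']
    rw [this]; ring
  have hXeq : ∀ j x, s j * X j x - (X j (x - 1) + X j (x + 1)) = e j * A x := by
    intro j x
    simp only [hX, hA]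
    have h1 : ∀ i, a i * ((r j + (r j)⁻¹) * r j ^ (x - τ i).natAbs -
        (r j ^ (x - 1 - τ i).natAbs + r j ^ (x + 1 - τ i).natAbs))
        = c j * if x = τ i then a i else 0 := by
      intro i
      have := geom_eq (r j) (hr0 j) (x - τ i)
      rw [show x - 1 - τ i = x - τ i - 1 by ring, show x + 1 - τ i = x - τ i + 1 by ring, this]
      by_cases hxi : x = τ i
      · rw [if_pos hxi, if_pos (by omega)]; simp only [hc]; ring
      · rw [if_neg hxi, if_neg (by omega)]; ring
    have h2 := Finset.sum_congr rfl fun i (_ : i ∈ Finset.univ) => h1 i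
    rw [← Finset.mul_sum] at h2
    have h3 : ∑ i, a i * ((r j + (r j)⁻¹) * r j ^ (x - τ i).natAbs -
        (r j ^ (x - 1 - τ i).natAbs + r j ^ (x + 1 - τ i).natAbs)) =
        s j * ∑ i, a i * r j ^ (x - τ i).natAbs - (∑ i, a i * r j ^ (x - 1 - τ i).natAbs
          + ∑ i, a i * r j ^ (x + 1 - τ i).natAbs) := by
      rw [Finset.mul_sum, ← Finset.sum_add_distrib, ← Finset.sum_sub_distrib]
      exact Finset.sum_congr rfl fun i _ => by simp only [hs]; ring
    rw [h3] at h2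
    have := (hc0 j).ne'
    calc _ = e j / c j * (s j * ∑ i, a i * r j ^ (x - τ i).natAbs -
          (∑ i, a i * r j ^ (x - 1 - τ i).natAbs + ∑ i, a i * r j ^ (x + 1 - τ i).natAbs)) := by ring
      _ = _ := by rw [h2]; field_simp
  have hXt : ∀ j, Filter.Tendsto (X j) Filter.cofinite (nhds 0) := by
    intro j
    have h1 : Filter.Tendsto (fun x : ℤ => ∑ i, a i * r j ^ (x - τ i).natAbs) Filter.cofinite
        (nhds (∑ i, a i * 0)) :=
      tendsto_finsetSum _ fun i _ => (geom_tendsto (r j) (hr0 j) (hr1 j) (τ i)).const_mul (a i)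
    have := h1.const_mul (e j / c j)
    simpa using this
  have hut : Filter.Tendsto u Filter.cofinite (nhds 0) := by
    have h1 : Filter.Tendsto (fun x : ℤ => ∑ j, e j * X j x) Filter.cofinite
        (nhds (∑ j, e j * 0)) := tendsto_finsetSum _ fun j _ => (hXt j).const_mul (e j)
    have h2 : u = fun x : ℤ => ∑ j, e j * X j x := funext huX
    rw [h2]; simpa using h1
  set U : Fin n → ℤ → ℝ := fun k x => -β k * ∑ j, f k j * X j x with hU
  have hUt : ∀ k, Filter.Tendsto (U k) Filter.cofinite (nhds 0) := by
    intro k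
    have h1 : Filter.Tendsto (fun x : ℤ => ∑ j, f k j * X j x) Filter.cofinite
        (nhds (∑ j, f k j * 0)) := tendsto_finsetSum _ fun j _ => (hXt j).const_mul (f k j)
    have h2 := h1.const_mul (-β k)
    simp only [mul_zero, Finset.sum_const_zero] at h2
    exact h2
  have hUeq : ∀ k x, σ k * U k x - (U k (x - 1) + U k (x + 1)) = β k ^ 2 * u x := by
    intro k x
    have h1 : ∀ j, f k j * (σ k * X j x - (X j (x - 1) + X j (x + 1)))
        = (f k j * e j) * A x - β k * (e j * X j x) := by
      intro j
      linear_combination f k j * hXeq j x - X j x * hf k j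
    have h2 := Finset.sum_congr rfl fun j (_ : j ∈ Finset.univ) => h1 j
    rw [Finset.sum_sub_distrib, ← Finset.sum_mul, horth, ← Finset.mul_sum, ← huX] at h2
    have h3 : ∑ j, f k j * (σ k * X j x - (X j (x - 1) + X j (x + 1))) =
        σ k * ∑ j, f k j * X j x - (∑ j, f k j * X j (x - 1) + ∑ j, f k j * X j (x + 1)) := by
      rw [Finset.mul_sum, ← Finset.sum_add_distrib, ← Finset.sum_sub_distrib]
      exact Finset.sum_congr rfl fun i _ => by ring
    rw [h3] at h2
    simp only [hU]
    linear_combination (-β k) * h2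
  have hueq : ∀ x, d * u x - (u (x - 1) + u (x + 1)) = V * A x + ∑ k, U k x := by
    intro x
    have h1 : ∀ j, d * (e j * X j x) - (e j * X j (x - 1) + e j * X j (x + 1))
        = e j ^ 2 * A x - ∑ k, β k * (f k j * X j x) := by
      intro j
      have : ∑ k, β k * (f k j * X j x) = (∑ k, β k * f k j) * X j x := by
        rw [Finset.sum_mul]; exact Finset.sum_congr rfl fun k _ => by ring
      rw [this]
      linear_combination e j * hXeq j x - X j x * hee j
    have h2 := Finset.sum_congr rfl fun j (_ : j ∈ Finset.univ) => h1 j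
    rw [Finset.sum_sub_distrib, Finset.sum_sub_distrib, Finset.sum_add_distrib, ← Finset.mul_sum,
      ← huX, ← huX, ← huX, ← Finset.sum_mul, ← hV, Finset.sum_comm] at h2
    rw [h2, sub_eq_add_neg, ← Finset.sum_neg_distrib]
    congr 1
    refine Finset.sum_congr rfl fun k _ => ?_
    simp only [hU]
    rw [← Finset.mul_sum]; ring
  have hu0 : ∀ x, 0 ≤ u x := by
    by_contra hneg
    push Not at hneg
    obtain ⟨x1, hx1⟩ := hneg
    obtain ⟨x0, h1, h2⟩ := min_attained u hut x1 hx1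
    have hx0 : u x0 < 0 := by linarith
    have hA0 : 0 ≤ A x0 := by
      refine Finset.sum_nonneg fun i _ => ?_
      by_cases hi : x0 = τ i
      · rw [if_pos hi]
        rcases ha i with h | h
        · exact h
        · exfalso
          have : 0 ≤ u (τ i) := h
          rw [← hi] at this; linarith
      · rw [if_neg hi]
    have hUl : ∀ k, β k ^ 2 / (σ k - 2) * u x0 ≤ U k x0 := by
      intro k
      have := resolvent_lower (U k) (hUt k) (σ k) (β k ^ 2 * u x0) (hσ k)
        (mul_nonpos_of_nonneg_of_nonpos (sq_nonneg _) hx0.le)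
        (fun x => by rw [hUeq]; exact mul_le_mul_of_nonneg_left (h2 x) (sq_nonneg _)) x0
      rw [div_mul_eq_mul_div]; exact this
    have h3 := Finset.sum_le_sum fun k (_ : k ∈ Finset.univ) => hUl k
    rw [← Finset.sum_mul] at h3
    have h4 := hueq x0
    have h5 := h2 (x0 - 1)
    have h6 := h2 (x0 + 1)
    have h7 := mul_nonneg hV0.le hA0
    have h8 := mul_neg_of_pos_of_neg hpos hx0
    nlinarith
  refine ⟨hu0, fun hinj i hi => ?_⟩
  have hUl : ∀ k, 0 ≤ U k (τ i) := by
    intro k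
    have := resolvent_lower (U k) (hUt k) (σ k) 0 (hσ k) le_rfl
      (fun x => by rw [hUeq]; exact mul_nonneg (sq_nonneg _) (hu0 x)) (τ i)
    simpa using this
  have hi' : u (τ i) = 0 := hi
  have h4 := hueq (τ i)
  have hAi : A (τ i) = a i := by
    simp only [hA]
    rw [Finset.sum_eq_single i]
    · simp
    · intro b _ hb
      rw [if_neg (fun h => hb (hinj h).symm)]
    · simp
  rw [hAi, hi'] at h4
  have h5 := Finset.sum_nonneg fun k (_ : k ∈ Finset.univ) => hUl k
  have h6 := hu0 (τ i - 1)
  have h7 := hu0 (τ i + 1)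
  by_contra hcon
  push Not at hcon
  have := mul_pos hV0 hcon
  linarith

/-- finite mixtures of geometric kernels on the lattice -/
def IsMix (K : ℤ → ℝ) : Prop :=
  ∃ (J : ℕ) (w r : Fin J → ℝ), (∀ j, 0 ≤ w j) ∧ (∀ j, 0 < r j) ∧ (∀ j, r j < 1) ∧
    ∀ n, K n = ∑ j, w j * r j ^ n.natAbs

theorem exists_mix (f : ℝ → ℝ) (hf : ∀ n, CMn n f) (h : ℝ) (hh : 0 < h) (L : ℕ) (ε : ℝ)
    (hε : 0 < ε) :
    ∃ K, IsMix K ∧ ∀ n : ℤ, n.natAbs ≤ L → |K n - f (((n.natAbs : ℝ) + 1) * h)| ≤ ε := by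
  obtain ⟨J, w, r, h1, h2, h3, h4⟩ := hausdorff_approx (fun n : ℕ => f ((n + 1) * h))
    (fun k n => cmn_seq k f h hh (hf k) n) L ε hε
  exact ⟨fun n => ∑ j, w j * r j ^ n.natAbs, ⟨J, w, r, h1, h2, h3, fun n => rfl⟩,
    fun n hn => h4 _ hn⟩

theorem floor_tendsto (x : ℝ) :
    Filter.Tendsto (fun M : ℕ => (⌊((M:ℝ) + 1) * x⌋ : ℝ) / ((M:ℝ) + 1)) Filter.atTop (nhds x) := by
  have h := (tendsto_nat_floor_mul_div_atTop (R := ℝ) (a := 1) zero_le_one)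
  have hM : Filter.Tendsto (fun M : ℕ => (M:ℝ) + 1) Filter.atTop Filter.atTop :=
    Filter.tendsto_atTop_add_const_right _ _ tendsto_natCast_atTop_atTop
  have h1 : Filter.Tendsto (fun M : ℕ => x - 1 / ((M:ℝ) + 1)) Filter.atTop (nhds x) := by
    have := (tendsto_one_div_add_atTop_nhds_zero_nat (𝕜 := ℝ)).const_sub x
    simpa using this
  refine tendsto_of_tendsto_of_tendsto_of_le_of_le h1 tendsto_const_nhds (fun M => ?_) (fun M => ?_)
  · have hp : (0:ℝ) < M + 1 := by positivity
    have := Int.sub_one_lt_floor (((M:ℝ) + 1) * x)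
    simp only
    rw [le_div_iff₀ hp]
    have : (x - 1 / ((M:ℝ) + 1)) * (M + 1) = (M + 1) * x - 1 := by field_simp
    linarith
  · have hp : (0:ℝ) < M + 1 := by positivity
    have := Int.floor_le (((M:ℝ) + 1) * x)
    simp only
    rw [div_le_iff₀ hp]
    linarith

theorem exists_kernels (f Ψ : ℝ → ℝ) (hf : ∀ n, CMn n f) (hΨf : ∀ x, 0 < x → Ψ x = f x)
    (hΨc : Continuous Ψ) (hΨe : ∀ x, Ψ (-x) = Ψ x) :
    ∃ K : ℕ → ℤ → ℝ, (∀ M, IsMix (K M)) ∧ ∀ x y : ℝ, Filter.Tendsto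
      (fun M : ℕ => K M (⌊((M:ℝ) + 1) * x⌋ - ⌊((M:ℝ) + 1) * y⌋)) Filter.atTop
      (nhds (Ψ (x - y))) := by
  have hex : ∀ M : ℕ, ∃ K, IsMix K ∧ ∀ n : ℤ, n.natAbs ≤ (M + 1) ^ 2 →
      |K n - f (((n.natAbs : ℝ) + 1) * (1 / ((M:ℝ) + 1)))| ≤ 1 / ((M:ℝ) + 1) := fun M =>
    exists_mix f hf _ (by positivity) _ _ (by positivity)
  choose K hK1 hK2 using hex
  refine ⟨K, hK1, fun x y => ?_⟩
  set n : ℕ → ℤ := fun M => ⌊((M:ℝ) + 1) * x⌋ - ⌊((M:ℝ) + 1) * y⌋ with hn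
  have hz := tendsto_one_div_add_atTop_nhds_zero_nat (𝕜 := ℝ)
  have habs : Filter.Tendsto (fun M : ℕ => ((n M).natAbs : ℝ) / ((M:ℝ) + 1)) Filter.atTop
      (nhds |x - y|) := by
    have := ((floor_tendsto x).sub (floor_tendsto y)).abs
    refine this.congr fun M => ?_
    have hp : (0:ℝ) < M + 1 := by positivity
    rw [← sub_div, abs_div, abs_of_pos hp, Nat.cast_natAbs]
    simp only [hn]
    push_cast
    rfl
  have harg : Filter.Tendsto (fun M : ℕ => (((n M).natAbs : ℝ) + 1) * (1 / ((M:ℝ) + 1)))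
      Filter.atTop (nhds |x - y|) := by
    have := habs.add hz
    rw [add_zero] at this
    exact this.congr fun M => by ring
  have hΨabs : Ψ |x - y| = Ψ (x - y) := by
    rcases abs_choice (x - y) with h | h <;> rw [h]
    exact hΨe _
  have hlim : Filter.Tendsto (fun M : ℕ => f ((((n M).natAbs : ℝ) + 1) * (1 / ((M:ℝ) + 1))))
      Filter.atTop (nhds (Ψ (x - y))) := by
    rw [← hΨabs]
    refine ((hΨc.tendsto _).comp harg).congr fun M => ?_
    exact hΨf _ (by positivity)
  have hev : ∀ᶠ M : ℕ in Filter.atTop, (n M).natAbs ≤ (M + 1) ^ 2 := by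
    have h1 := habs.eventually (gt_mem_nhds (show |x - y| < |x - y| + 1 by linarith))
    have h2 : ∀ᶠ M : ℕ in Filter.atTop, |x - y| + 1 ≤ (M:ℝ) :=
      tendsto_natCast_atTop_atTop.eventually_ge_atTop _
    filter_upwards [h1, h2] with M h1 h2
    have hp : (0:ℝ) < M + 1 := by positivity
    rw [div_lt_iff₀ hp] at h1
    have : ((n M).natAbs : ℝ) ≤ ((M:ℝ) + 1) ^ 2 := by nlinarith
    exact_mod_cast this
  have hdiff : Filter.Tendsto (fun M : ℕ => K M (n M) -
      f ((((n M).natAbs : ℝ) + 1) * (1 / ((M:ℝ) + 1)))) Filter.atTop (nhds 0) := by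
    refine squeeze_zero_norm' ?_ hz
    filter_upwards [hev] with M hM
    exact hK2 M _ hM
  have := hdiff.add hlim
  rw [zero_add] at this
  exact this.congr fun M => by ring

theorem floor_ne (s t : ℝ) (h : s ≠ t) :
    ∀ᶠ M : ℕ in Filter.atTop, ⌊((M:ℝ) + 1) * s⌋ ≠ ⌊((M:ℝ) + 1) * t⌋ := by
  have h0 : 0 < |s - t| := abs_pos.2 (sub_ne_zero.2 h)
  have h2 : ∀ᶠ M : ℕ in Filter.atTop, 1 / |s - t| ≤ (M:ℝ) :=
    tendsto_natCast_atTop_atTop.eventually_ge_atTop _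
  filter_upwards [h2] with M hM heq
  have := Int.abs_sub_lt_one_of_floor_eq_floor heq
  rw [← mul_sub, abs_mul, abs_of_pos (by positivity : (0:ℝ) < M + 1)] at this
  rw [div_le_iff₀ h0] at hM
  linarith

theorem tendsto_solve {k : ℕ} (GM : ℕ → Matrix (Fin k) (Fin k) ℝ) (G : Matrix (Fin k) (Fin k) ℝ)
    (hGt : Filter.Tendsto GM Filter.atTop (nhds G)) (hdet : G.det ≠ 0)
    (gM : ℕ → Fin k → ℝ) (g : Fin k → ℝ) (hgt : Filter.Tendsto gM Filter.atTop (nhds g)) :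
    Filter.Tendsto (fun M => (GM M).det) Filter.atTop (nhds G.det) ∧
    Filter.Tendsto (fun M => (GM M)⁻¹.mulVec (gM M)) Filter.atTop (nhds (G⁻¹.mulVec g)) := by
  have hdc : Continuous fun A : Matrix (Fin k) (Fin k) ℝ => A.det := continuous_id.matrix_det
  have hac : Continuous fun A : Matrix (Fin k) (Fin k) ℝ => A.adjugate :=
    continuous_id.matrix_adjugate
  have hdt : Filter.Tendsto (fun M => (GM M).det) Filter.atTop (nhds G.det) :=
    (hdc.tendsto G).comp hGt
  have hat : Filter.Tendsto (fun M => (GM M).adjugate) Filter.atTop (nhds G.adjugate) :=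
    (hac.tendsto G).comp hGt
  refine ⟨hdt, tendsto_pi_nhds.2 fun i => ?_⟩
  have hat2 : ∀ j, Filter.Tendsto (fun M => (GM M).adjugate i j) Filter.atTop
      (nhds (G.adjugate i j)) := fun j => tendsto_pi_nhds.1 (tendsto_pi_nhds.1 hat i) j
  have hmt : Filter.Tendsto (fun M => ∑ j, (GM M).adjugate i j * gM M j) Filter.atTop
      (nhds (∑ j, G.adjugate i j * g j)) :=
    tendsto_finsetSum _ fun j _ => (hat2 j).mul (tendsto_pi_nhds.1 hgt j)
  have h := (hdt.inv₀ hdet).mul hmt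
  have hval : ∀ (A : Matrix (Fin k) (Fin k) ℝ) (v : Fin k → ℝ),
      A⁻¹.mulVec v i = A.det⁻¹ * ∑ j, A.adjugate i j * v j := by
    intro A v
    rw [Matrix.inv_def, Ring.inverse_eq_inv', Matrix.smul_mulVec]
    rfl
  simp only [hval]
  exact h

theorem limit_principle (f Ψ : ℝ → ℝ) (hf : ∀ n, CMn n f) (hΨf : ∀ x, 0 < x → Ψ x = f x)
    (hΨc : Continuous Ψ) (hΨe : ∀ x, Ψ (-x) = Ψ x) (hΨ0 : Ψ 0 = 1) {k : ℕ} (t : Fin k → ℝ)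
    (ht : Function.Injective t) (θ : ℝ) (hθ : ∀ i, θ ≠ t i) (G : Matrix (Fin k) (Fin k) ℝ)
    (hG : ∀ i j, G i j = Ψ (t i - t j)) (hdet : G.det ≠ 0) (c : Fin k → ℝ)
    (hc : c = G⁻¹.mulVec fun i => Ψ (θ - t i)) :
    (∀ i, 0 ≤ c i) ∧ ∀ x, 0 ≤ Ψ (x - θ) - ∑ i, c i * Ψ (x - t i) := by
  obtain ⟨K, hK1, hK2⟩ := exists_kernels f Ψ hf hΨf hΨc hΨe
  set F : ℕ → ℝ → ℤ := fun M x => ⌊((M:ℝ) + 1) * x⌋ with hF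
  set GM : ℕ → Matrix (Fin k) (Fin k) ℝ :=
    fun M => Matrix.of fun i j => K M (F M (t i) - F M (t j)) with hGM
  set gM : ℕ → Fin k → ℝ := fun M i => K M (F M (t i) - F M θ) with hgM
  set cM : ℕ → Fin k → ℝ := fun M => (GM M)⁻¹.mulVec (gM M) with hcM
  have hGt : Filter.Tendsto GM Filter.atTop (nhds G) := by
    refine tendsto_pi_nhds.2 fun i => tendsto_pi_nhds.2 fun j => ?_
    rw [hG]
    exact hK2 (t i) (t j)
  have hgt : Filter.Tendsto gM Filter.atTop (nhds fun i => Ψ (θ - t i)) := by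
    refine tendsto_pi_nhds.2 fun i => ?_
    rw [← hΨe, neg_sub]
    exact hK2 (t i) θ
  obtain ⟨hdt, hct⟩ := tendsto_solve GM G hGt hdet gM _ hgt
  rw [← hc] at hct
  have hcti := tendsto_pi_nhds.1 hct
  have e1 : ∀ᶠ M in Filter.atTop, (GM M).det ≠ 0 := hdt.eventually_ne hdet
  have e2 : ∀ᶠ M : ℕ in Filter.atTop, 0 < K M 0 := by
    have := hK2 0 0
    rw [sub_zero, hΨ0] at this
    simp only [sub_self] at this
    exact this.eventually (lt_mem_nhds one_pos)
  have e3 : ∀ᶠ M : ℕ in Filter.atTop, ∀ i, F M θ ≠ F M (t i) :=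
    Filter.eventually_all.2 fun i => floor_ne _ _ (hθ i)
  have e4 : ∀ᶠ M : ℕ in Filter.atTop, ∀ i j, i ≠ j → F M (t i) ≠ F M (t j) := by
    refine Filter.eventually_all.2 fun i => Filter.eventually_all.2 fun j => ?_
    by_cases hij : i = j
    · exact Filter.Eventually.of_forall fun M h => absurd hij h
    · filter_upwards [floor_ne (t i) (t j) (fun h => hij (ht h))] with M hM _
      exact hM
  have main : ∀ᶠ M : ℕ in Filter.atTop, (∀ i, 0 ≤ cM M i) ∧
      ∀ z : ℤ, 0 ≤ K M (z - F M θ) - ∑ i, cM M i * K M (z - F M (t i)) := by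
    filter_upwards [e1, e2, e3, e4] with M e1 e2 e3 e4
    obtain ⟨J, w, r, hw, hr0, hr1, hK⟩ := hK1 M
    have hw' : 0 < ∑ j, w j := by
      rw [hK] at e2; simpa using e2
    have hsol : (GM M).mulVec (cM M) = gM M := by
      simp only [hcM]
      rw [Matrix.mulVec_mulVec, Matrix.mul_nonsing_inv _ (isUnit_iff_ne_zero.2 e1),
        Matrix.one_mulVec]
    set τ : Option (Fin k) → ℤ := fun o => o.elim (F M θ) (fun i => F M (t i)) with hτ
    set a : Option (Fin k) → ℝ := fun o => o.elim 1 (fun i => - cM M i) with ha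
    have hsum : ∀ z, ∑ o, a o * K M (z - τ o)
        = K M (z - F M θ) - ∑ i, cM M i * K M (z - F M (t i)) := by
      intro z
      rw [Fintype.sum_option]
      simp [ha, hτ, Finset.sum_neg_distrib, sub_eq_add_neg]
    have hnode : ∀ i, ∑ o, a o * K M (τ (some i) - τ o) = 0 := by
      intro i
      rw [hsum]
      have := congrFun hsol i
      simp only [Matrix.mulVec, dotProduct, hGM, hgM, Matrix.of_apply] at this
      simp only [hτ, Option.elim]
      rw [← this, sub_eq_zero]
      exact Finset.sum_congr rfl fun j _ => mul_comm _ _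
    have hinj : Function.Injective τ := by
      rintro (_ | i) (_ | j) h
      · rfl
      · exact absurd h (e3 j)
      · exact absurd h.symm (e3 i)
      · by_contra hne
        exact e4 i j (fun h => hne (by rw [h])) h
    obtain ⟨p1, p2⟩ := mixture_principle w r hw hw' hr0 hr1 (K M) hK τ a (by
      rintro (_ | i)
      · left; simp [ha]
      · right; rw [hnode])
    refine ⟨fun i => ?_, fun z => ?_⟩
    · have := p2 hinj (some i) (hnode i)
      simpa [ha] using this
    · rw [← hsum]; exact p1 z
  refine ⟨fun i => ?_, fun x => ?_⟩
  · exact ge_of_tendsto (hcti i) (main.mono fun M h => h.1 i)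
  · have hl : Filter.Tendsto (fun M => K M (F M x - F M θ) - ∑ i, cM M i * K M (F M x - F M (t i)))
        Filter.atTop (nhds (Ψ (x - θ) - ∑ i, c i * Ψ (x - t i))) :=
      (hK2 x θ).sub (tendsto_finsetSum _ fun i _ => (hcti i).mul (hK2 x (t i)))
    exact ge_of_tendsto hl (main.mono fun M h => h.2 _)

theorem tail_integral (Ψ : ℝ → ℝ) (l : Filter ℝ) (hl : Filter.Tendsto Ψ Filter.atTop (nhds 0))
    (s : ℝ) :
    Filter.Tendsto (fun R : ℝ => ∫ x in (R - s)..R, Ψ x) Filter.atTop (nhds 0) := by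
  rw [Metric.tendsto_atTop]
  intro ε hε
  rw [Metric.tendsto_atTop] at hl
  obtain ⟨N, hN⟩ := hl (ε / (|s| + 1)) (by positivity)
  refine ⟨N + |s|, fun R hR => ?_⟩
  rw [dist_zero_right]
  have h1 : ∀ x ∈ Set.uIoc (R - s) R, ‖Ψ x‖ ≤ ε / (|s| + 1) := by
    intro x hx
    have hx' : N ≤ x := by
      rw [Set.uIoc, Set.mem_Ioc] at hx
      have := hx.1
      have h2 : R - |s| ≤ min (R - s) R := by
        refine le_min ?_ ?_
        · have := le_abs_self s; linarith
        · have := abs_nonneg s; linarith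
      linarith
    have := hN x hx'
    rw [dist_zero_right] at this
    exact this.le
  have h2 := intervalIntegral.norm_integral_le_of_norm_le_const h1
  refine lt_of_le_of_lt h2 ?_
  rw [sub_sub_cancel, div_mul_eq_mul_div, div_lt_iff₀ (by positivity)]
  nlinarith [abs_nonneg s]

theorem shift_integral (Ψ : ℝ → ℝ) (hΨc : Continuous Ψ) (hΨe : ∀ x, Ψ (-x) = Ψ x)
    (hl : Filter.Tendsto Ψ Filter.atTop (nhds 0)) (s : ℝ) :
    Filter.Tendsto (fun R : ℝ => (∫ x in (-R)..R, Ψ (x - s)) - ∫ x in (-R)..R, Ψ x)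
      Filter.atTop (nhds 0) := by
  have hi : ∀ a b, IntervalIntegrable Ψ MeasureTheory.volume a b := fun a b =>
    hΨc.intervalIntegrable a b
  have h1 := tail_integral Ψ Filter.atTop hl s
  have h2 := tail_integral Ψ Filter.atTop hl (-s)
  have h3 := (h1.add h2).neg
  simp only [add_zero, neg_zero] at h3
  refine h3.congr fun R => ?_
  rw [intervalIntegral.integral_comp_sub_right (fun x => Ψ x) s]
  have e1 : ∫ x in (R - -s)..R, Ψ x = ∫ x in (-R)..(-R - s), Ψ x := by
    have := intervalIntegral.integral_comp_neg (a := -R) (b := -R - s) (fun x => Ψ x)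
    simp only [hΨe] at this
    rw [this]
    congr 1 <;> ring
  rw [e1]
  have a1 := intervalIntegral.integral_add_adjacent_intervals (hi (-R) (-R - s)) (hi (-R - s) (R - s))
  have a2 := intervalIntegral.integral_add_adjacent_intervals (hi (-R) (R - s)) (hi (R - s) R)
  linarith

theorem sum_lt_one (Ψ : ℝ → ℝ) (hΨc : Continuous Ψ) (hΨe : ∀ x, Ψ (-x) = Ψ x) (hΨ0 : Ψ 0 = 1)
    (hΨn : ∀ x, 0 ≤ Ψ x) (hΨ1 : ∀ x, x ≠ 0 → Ψ x < 1)
    (hl : Filter.Tendsto Ψ Filter.atTop (nhds 0)) {k : ℕ} (t : Fin k → ℝ)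
    (θ : ℝ) (hθ : ∀ i, θ ≠ t i) (c : Fin k → ℝ) (hc : ∀ i, 0 ≤ c i)
    (hu : ∀ x, 0 ≤ Ψ (x - θ) - ∑ i, c i * Ψ (x - t i)) : ∑ i, c i < 1 := by
  by_contra hcon
  push Not at hcon
  set u : ℝ → ℝ := fun x => Ψ (x - θ) - ∑ i, c i * Ψ (x - t i) with hudef
  have hs : ∀ s, Continuous fun x => Ψ (x - s) := fun s => hΨc.comp (continuous_id.sub continuous_const)
  have huc : Continuous u := (hs θ).sub (continuous_finsetSum _ fun i _ => (hs (t i)).const_mul _)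
  set I : ℝ → ℝ := fun R => ∫ x in (-R)..R, Ψ x with hI
  set E : ℝ → ℝ → ℝ := fun s R => (∫ x in (-R)..R, Ψ (x - s)) - I R with hE
  have hEt : ∀ s, Filter.Tendsto (E s) Filter.atTop (nhds 0) := shift_integral Ψ hΨc hΨe hl
  have hIntEq : ∀ R, ∫ x in (-R)..R, u x = (1 - ∑ i, c i) * I R + (E θ R - ∑ i, c i * E (t i) R) := by
    intro R
    simp only [hudef]
    rw [intervalIntegral.integral_sub ((hs θ).intervalIntegrable _ _)
      ((continuous_finsetSum _ fun i _ => (hs (t i)).const_mul _).intervalIntegrable _ _),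
      intervalIntegral.integral_finsetSum
        (fun i _ => ((hs (t i)).const_mul _).intervalIntegrable _ _)]
    simp only [intervalIntegral.integral_const_mul, hE, mul_sub, Finset.sum_sub_distrib,
      ← Finset.sum_mul]
    ring
  have hEt2 : Filter.Tendsto (fun R => E θ R - ∑ i, c i * E (t i) R) Filter.atTop (nhds 0) := by
    have h1 : Filter.Tendsto (fun R => ∑ i, c i * E (t i) R) Filter.atTop
        (nhds (∑ i, c i * 0)) := tendsto_finsetSum _ fun i _ => (hEt (t i)).const_mul (c i)
    have := (hEt θ).sub h1
    simpa using this
  have hmono : ∀ v : ℝ → ℝ, Continuous v → (∀ x, 0 ≤ v x) → ∀ R₀ R, 0 ≤ R₀ → R₀ ≤ R →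
      ∫ x in (-R₀)..R₀, v x ≤ ∫ x in (-R)..R, v x := by
    intro v hv hv0 R₀ R h0 hR
    exact intervalIntegral.integral_mono_interval (by linarith) (by linarith) hR
      (Filter.Eventually.of_forall hv0) (hv.intervalIntegrable _ _)
  have hposint : ∀ v : ℝ → ℝ, Continuous v → (∀ x, 0 ≤ v x) → ∀ R y, -R ≤ y → y ≤ R → 0 < R →
      0 < v y → 0 < ∫ x in (-R)..R, v x := by
    intro v hv hv0 R y h1 h2 h3 hy
    exact intervalIntegral.integral_pos (by linarith) hv.continuousOn (fun x _ => hv0 x)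
      ⟨y, ⟨h1, h2⟩, hy⟩
  have hI1 : 0 < I 1 := hposint Ψ hΨc hΨn 1 0 (by norm_num) (by norm_num) one_pos (by rw [hΨ0]; norm_num)
  have key : ∀ R₀, 0 ≤ R₀ → ∫ x in (-R₀)..R₀, u x ≤ (1 - ∑ i, c i) * I 1 := by
    intro R₀ h0
    have hlim : Filter.Tendsto (fun R => (1 - ∑ i, c i) * I 1 + (E θ R - ∑ i, c i * E (t i) R))
        Filter.atTop (nhds ((1 - ∑ i, c i) * I 1)) := by
      have := hEt2.const_add ((1 - ∑ i, c i) * I 1)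
      simpa using this
    refine ge_of_tendsto hlim ?_
    filter_upwards [Filter.eventually_ge_atTop R₀, Filter.eventually_ge_atTop 1] with R h1 h2
    refine (hmono u huc hu R₀ R h0 h1).trans ?_
    rw [hIntEq]
    have : I 1 ≤ I R := hmono Ψ hΨc hΨn 1 R zero_le_one h2
    have h3 : (1 - ∑ i, c i) * I R ≤ (1 - ∑ i, c i) * I 1 :=
      mul_le_mul_of_nonpos_left this (by linarith)
    linarith
  have hle : ∑ i, c i ≤ 1 := by
    have h := key 0 le_rfl
    simp at h
    by_contra h'
    push Not at h'
    nlinarith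
  have hone : ∑ i, c i = 1 := le_antisymm hle hcon
  have huθ : 0 < u θ := by
    have h1 : u θ = ∑ i, c i * (1 - Ψ (θ - t i)) := by
      simp only [hudef, sub_self, hΨ0, mul_sub, Finset.sum_sub_distrib, mul_one, hone]
    rw [h1]
    obtain ⟨i, _, hi⟩ := Finset.exists_lt_of_sum_lt (s := Finset.univ) (f := fun _ : Fin k => (0:ℝ))
      (g := c) (by simp [hone])
    exact Finset.sum_pos' (fun i _ => mul_nonneg (hc i) (by
      have := hΨ1 _ (sub_ne_zero.2 (hθ i)); linarith)) ⟨i, Finset.mem_univ _, mul_pos hi (by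
      have := hΨ1 _ (sub_ne_zero.2 (hθ i)); linarith)⟩
  have h1 := key (|θ| + 1) (by positivity)
  have h2 := hposint u huc hu (|θ| + 1) θ (by have := neg_abs_le θ; linarith)
    (by have := le_abs_self θ; linarith) (by positivity) huθ
  rw [hone] at h1
  linarith

theorem cmn_lt_one (f Ψ : ℝ → ℝ) (hf : ∀ n, CMn n f) (hΨf : ∀ x, 0 < x → Ψ x = f x)
    (hΨc : Continuous Ψ) (hΨe : ∀ x, Ψ (-x) = Ψ x) (hΨ0 : Ψ 0 = 1)
    (hl : Filter.Tendsto Ψ Filter.atTop (nhds 0)) : ∀ x, x ≠ 0 → Ψ x < 1 := by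
  have hle : ∀ x, 0 < x → f x ≤ 1 := by
    intro x hx
    have h1 : Filter.Tendsto Ψ (nhdsWithin 0 (Set.Ioi 0)) (nhds 1) := by
      rw [← hΨ0]; exact (hΨc.tendsto 0).mono_left nhdsWithin_le_nhds
    refine ge_of_tendsto h1 ?_
    filter_upwards [Ioo_mem_nhdsGT hx] with y hy
    rw [hΨf y hy.1]
    exact (hf 1).anti hy.1 hx hy.2.le
  have hpos : ∀ x, 0 < x → f x < 1 := by
    intro x hx
    refine lt_of_le_of_ne (hle x hx) fun hx1 => ?_
    have hh : 0 < x / 2 := by linarith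
    have hf1 : f (x / 2) = 1 := le_antisymm (hle _ hh) (by
      rw [← hx1]; exact (hf 1).anti hh hx (by linarith))
    have hd := ((hf 2).diff (x / 2) hh).anti
    have hall : ∀ n : ℕ, 1 ≤ f ((n + 1) * (x / 2)) := by
      intro n
      induction n with
      | zero => simp [hf1]
      | succ n ih =>
        have h1 := hd (show (0:ℝ) < x / 2 from hh) (show (0:ℝ) < (n + 1) * (x / 2) by positivity)
          (by nlinarith [mul_nonneg (Nat.cast_nonneg (α := ℝ) n) hh.le])
        simp only at h1
        rw [add_halves, hf1, hx1] at h1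
        have e : ((n + 1 : ℕ) + 1 : ℝ) * (x / 2) = (n + 1) * (x / 2) + x / 2 := by
          push_cast; ring
        rw [e]; linarith
    have ht : Filter.Tendsto (fun n : ℕ => ((n:ℝ) + 1) * (x / 2)) Filter.atTop Filter.atTop :=
      (Filter.tendsto_atTop_add_const_right _ _ tendsto_natCast_atTop_atTop).atTop_mul_const hh
    have := ge_of_tendsto (hl.comp ht) (Filter.Eventually.of_forall fun n => by
      show (1:ℝ) ≤ _
      rw [Function.comp_apply, hΨf _ (by positivity)]; exact hall n)
    linarith
  intro x hx
  rcases lt_or_gt_of_ne hx with h | h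
  · rw [← hΨe, hΨf _ (by linarith)]; exact hpos _ (by linarith)
  · rw [hΨf _ h]; exact hpos _ h

theorem erc_core (f Ψ : ℝ → ℝ) (hf : ∀ n, CMn n f) (hΨf : ∀ x, 0 < x → Ψ x = f x)
    (hΨc : Continuous Ψ) (hΨe : ∀ x, Ψ (-x) = Ψ x) (hΨ0 : Ψ 0 = 1)
    (hl : Filter.Tendsto Ψ Filter.atTop (nhds 0)) {k : ℕ} (t : Fin k → ℝ)
    (ht : Function.Injective t) (θ : ℝ) (hθ : ∀ i, θ ≠ t i) (G : Matrix (Fin k) (Fin k) ℝ)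
    (hG : ∀ i j, G i j = Ψ (t i - t j)) (hdet : G.det ≠ 0) (c : Fin k → ℝ)
    (hc : c = G⁻¹.mulVec fun i => Ψ (θ - t i)) :
    (∀ i, 0 ≤ c i) ∧ ∑ i, c i < 1 := by
  obtain ⟨h1, h2⟩ := limit_principle f Ψ hf hΨf hΨc hΨe hΨ0 t ht θ hθ G hG hdet c hc
  have hn : ∀ x, 0 ≤ Ψ x := by
    intro x
    rcases lt_trichotomy x 0 with h | h | h
    · rw [← hΨe, hΨf _ (by linarith)]; exact (hf 0).nonneg _ (by linarith)
    · rw [h, hΨ0]; norm_num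
    · rw [hΨf _ h]; exact (hf 0).nonneg _ h
  exact ⟨h1, sum_lt_one Ψ hΨc hΨe hΨ0 hn (cmn_lt_one f Ψ hf hΨf hΨc hΨe hΨ0 hl) hl t θ hθ c h1 h2⟩

theorem posdef_core (f Ψ : ℝ → ℝ) (hf : ∀ n, CMn n f) (hΨf : ∀ x, 0 < x → Ψ x = f x)
    (hΨc : Continuous Ψ) (hΨe : ∀ x, Ψ (-x) = Ψ x) (hΨ0 : Ψ 0 = 1)
    (hl : Filter.Tendsto Ψ Filter.atTop (nhds 0)) (k : ℕ) : ∀ (t : Fin k → ℝ),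
    Function.Injective t → (Matrix.of fun i j => Ψ (t i - t j)).PosDef := by
  have hsymm : ∀ x y, Ψ (x - y) = Ψ (y - x) := fun x y => by rw [← hΨe, neg_sub]
  have hlt := cmn_lt_one f Ψ hf hΨf hΨc hΨe hΨ0 hl
  have hherm : ∀ {k : ℕ} (t : Fin k → ℝ), (Matrix.of fun i j => Ψ (t i - t j)).IsHermitian := by
    intro k t
    ext i j
    simp [hsymm (t j) (t i)]
  have hquad : ∀ {k : ℕ} (t x : Fin k → ℝ),
      star x ⬝ᵥ ((Matrix.of fun i j => Ψ (t i - t j)).mulVec x)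
        = ∑ i, x i * ∑ j, Ψ (t i - t j) * x j := by
    intro k t x
    simp [dotProduct, Matrix.mulVec]
  induction k with
  | zero =>
    intro t _
    refine Matrix.PosDef.of_dotProduct_mulVec_pos (hherm t) fun x hx => ?_
    exact absurd (Subsingleton.elim x 0) hx
  | succ k ih =>
    intro t ht
    set t' : Fin k → ℝ := fun i => t i.succ with ht'
    have hinj' : Function.Injective t' := fun i j h => Fin.succ_injective _ (ht h)
    have hθ : ∀ i, t 0 ≠ t' i := fun i h => (Fin.succ_ne_zero i).symm (ht h)
    have hpd := ih t' hinj'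
    set G : Matrix (Fin k) (Fin k) ℝ := Matrix.of fun i j => Ψ (t' i - t' j) with hGdef
    have hdet : G.det ≠ 0 := hpd.det_pos.ne'
    set g : Fin k → ℝ := fun i => Ψ (t 0 - t' i) with hg
    set c : Fin k → ℝ := G⁻¹.mulVec g with hc
    obtain ⟨hc0, hc1⟩ := erc_core f Ψ hf hΨf hΨc hΨe hΨ0 hl t' hinj' (t 0) hθ G (fun i j => rfl)
      hdet c hc
    have hsol : ∀ i, ∑ j, Ψ (t' i - t' j) * c j = g i := by
      have : G.mulVec c = g := by
        rw [hc, Matrix.mulVec_mulVec, Matrix.mul_nonsing_inv _ (isUnit_iff_ne_zero.2 hdet),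
          Matrix.one_mulVec]
      intro i
      exact congrFun this i
    have hS : 0 < 1 - ∑ i, c i * g i := by
      have : ∑ i, c i * g i ≤ ∑ i, c i := Finset.sum_le_sum fun i _ => by
        have h1 : g i < 1 := hlt _ (sub_ne_zero.2 (hθ i))
        nlinarith [hc0 i]
      linarith
    refine Matrix.PosDef.of_dotProduct_mulVec_pos (hherm t) fun x hx => ?_
    rw [hquad]
    set y : Fin k → ℝ := fun i => x i.succ + x 0 * c i with hy
    have hQ : ∑ i, x i * ∑ j, Ψ (t i - t j) * x j
        = x 0 ^ 2 * (1 - ∑ i, c i * g i) + ∑ i, y i * ∑ j, Ψ (t' i - t' j) * y j := by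
      have e1 : ∀ i, ∑ j, Ψ (t' i - t' j) * y j
          = ∑ j, Ψ (t' i - t' j) * x j.succ + x 0 * g i := by
        intro i
        rw [← hsol i, Finset.mul_sum, ← Finset.sum_add_distrib]
        exact Finset.sum_congr rfl fun j _ => by simp only [hy]; ring
      have e2 : ∑ i, c i * ∑ j, Ψ (t' i - t' j) * x j.succ = ∑ j, g j * x j.succ := by
        simp_rw [Finset.mul_sum]
        rw [Finset.sum_comm]
        refine Finset.sum_congr rfl fun j _ => ?_
        rw [← hsol j, Finset.sum_mul]
        exact Finset.sum_congr rfl fun i _ => by rw [hsymm (t' i)]; ring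
      rw [Fin.sum_univ_succ, Fin.sum_univ_succ]
      simp only [Fin.sum_univ_succ (fun j => Ψ (t (Fin.succ _) - t j) * x j), e1, sub_self, hΨ0]
      have e3 : ∀ i : Fin k, x i.succ * (Ψ (t i.succ - t 0) * x 0 +
          ∑ j : Fin k, Ψ (t i.succ - t j.succ) * x j.succ)
          = x 0 * (g i * x i.succ) + x i.succ * ∑ j, Ψ (t' i - t' j) * x j.succ := by
        intro i
        rw [hsymm (t i.succ)]
        simp only [hg, ht']; ring
      have e4 : ∀ i : Fin k, y i * (∑ j, Ψ (t' i - t' j) * x j.succ + x 0 * g i)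
          = x i.succ * ∑ j, Ψ (t' i - t' j) * x j.succ + x 0 * (g i * x i.succ)
            + x 0 * (c i * ∑ j, Ψ (t' i - t' j) * x j.succ) + x 0 ^ 2 * (c i * g i) := by
        intro i
        simp only [hy]; ring
      rw [Finset.sum_congr rfl fun i _ => e3 i, Finset.sum_congr rfl fun i _ => e4 i]
      simp only [Finset.sum_add_distrib, ← Finset.mul_sum]
      rw [e2]
      have e5 : ∑ j : Fin k, Ψ (t 0 - t j.succ) * x j.succ = ∑ j, g j * x j.succ := rfl
      rw [e5]
      ring
    rw [hQ]
    have hyq : y ≠ 0 → 0 < ∑ i, y i * ∑ j, Ψ (t' i - t' j) * y j := by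
      intro h
      have := hpd.dotProduct_mulVec_pos h
      rw [hGdef, hquad] at this
      exact this
    by_cases h0 : x 0 = 0
    · have hy0 : y ≠ 0 := by
        intro h
        apply hx
        funext i
        refine Fin.cases h0 (fun j => ?_) i
        have := congrFun h j
        simpa [hy, h0] using this
      have := hyq hy0
      rw [h0]; simpa using this
    · have h1 : 0 < x 0 ^ 2 * (1 - ∑ i, c i * g i) := mul_pos (by positivity) hS
      by_cases hy0 : y = 0
      · simp only [hy0]; simpa using h1
      · linarith [hyq hy0]

/-- for a 1-D CMF kernel `κ(θ,θ') = φ(|θ-θ'|^p)` and pairwise distinct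
points, the Gram matrix is positive definite (hence invertible) and the Exact
Recovery Condition `‖G⁻¹ g_θ‖₁ < 1` holds off the support. -/
theorem cmf_1d_erc
    (φ : ℝ → ℝ) (hφ : IsCMF φ) (hφ0 : φ 0 = 1)
    (hφtop : Filter.Tendsto φ Filter.atTop (nhds 0))
    (p : ℝ) (hp0 : 0 < p) (hp1 : p ≤ 1)
    (k : ℕ) (hk : 1 ≤ k) (θs : Fin k → ℝ) (hinj : Function.Injective θs)
    (G : Matrix (Fin k) (Fin k) ℝ)
    (hG : ∀ ℓ ℓ', G ℓ ℓ' = φ (|θs ℓ - θs ℓ'| ^ p)) :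
    G.PosDef ∧ IsUnit G.det ∧
    ∀ θ : ℝ, (∀ ℓ, θ ≠ θs ℓ) →
      ∑ ℓ, |(G⁻¹.mulVec fun ℓ' => φ (|θ - θs ℓ'| ^ p)) ℓ| < 1 := by
  obtain ⟨h1, h2, h3⟩ := hφ
  set f : ℝ → ℝ := fun x => φ (x ^ p) with hf
  set Ψ : ℝ → ℝ := fun x => φ (|x| ^ p) with hΨ
  have hcm : ∀ n, CMn n f := cmn_psi h1 h3 p hp0 hp1
  have hΨf : ∀ x, 0 < x → Ψ x = f x := fun x hx => by simp only [hΨ, hf, abs_of_pos hx]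
  have hφc : ContinuousOn φ (Set.Ici 0) := by
    intro x hx
    rcases eq_or_lt_of_le (show (0:ℝ) ≤ x from hx) with h | h
    · rw [← h]; exact h2
    · exact (h1.continuousOn.continuousAt (Ioi_mem_nhds h)).continuousWithinAt
  have hΨc : Continuous Ψ :=
    hφc.comp_continuous (continuous_abs.rpow_const fun x => Or.inr hp0.le)
      fun x => Real.rpow_nonneg (abs_nonneg x) p
  have hΨe : ∀ x, Ψ (-x) = Ψ x := fun x => by simp only [hΨ, abs_neg]
  have hΨ0 : Ψ 0 = 1 := by simp only [hΨ, abs_zero, Real.zero_rpow hp0.ne', hφ0]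
  have hl : Filter.Tendsto Ψ Filter.atTop (nhds 0) :=
    hφtop.comp ((tendsto_rpow_atTop hp0).comp Filter.tendsto_abs_atTop_atTop)
  have hGeq : G = Matrix.of fun i j => Ψ (θs i - θs j) := by
    ext i j; exact hG i j
  have hpd : G.PosDef := by
    rw [hGeq]; exact posdef_core f Ψ hcm hΨf hΨc hΨe hΨ0 hl k θs hinj
  have hdet : G.det ≠ 0 := hpd.det_pos.ne'
  refine ⟨hpd, isUnit_iff_ne_zero.2 hdet, fun θ hθ => ?_⟩
  obtain ⟨hc0, hc1⟩ := erc_core f Ψ hcm hΨf hΨc hΨe hΨ0 hl θs hinj θ hθ G hG hdet _ rfl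
  calc _ = ∑ ℓ, (G⁻¹.mulVec fun ℓ' => Ψ (θ - θs ℓ')) ℓ :=
        Finset.sum_congr rfl fun ℓ _ => abs_of_nonneg (hc0 ℓ)
    _ < 1 := hc1
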